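/- For every a, b, c, d ∈ ℂ, define a' = (a+b+c+d)/2, b' = (a+b−c−d)/2, c' = (a−b+c−d)/2, d' = (−a+b+c−d)/2 and a'' = (a+b+c−d)/2, b'' = (a+b−c+d)/2, c'' = (a−b+c+d)/2, d'' = (a−b−c−d)/2. Then σ(a)σ(b)σ(c)σ(d) + σ(a')σ(b')σ(c')σ(d') + σ(a'')σ(b'')σ(c'')σ(d'') = 0 (Weierstrass's fundamental identity). -/

import Mathlib

open Complex

/-- The lattice point `2nω₁ + 2mω₃` associated to `(n, m) ∈ ℤ²`. -/
noncomputable def latticePoint (ω₁ ω₃ : ℂ) (p : ℤ × ℤ) : ℂ :=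
  2 * (p.1 : ℂ) * ω₁ + 2 * (p.2 : ℂ) * ω₃

/-- The Weierstrass sigma function with half-periods `ω₁, ω₃`,
`σ(z) = z ∏_{(n,m)≠(0,0)} (1 − z/w) exp(z/w + z²/(2w²))` with `w = 2nω₁ + 2mω₃`. -/
noncomputable def wSigma (ω₁ ω₃ z : ℂ) : ℂ :=
  z * ∏' p : {p : ℤ × ℤ // p ≠ (0, 0)},
    (1 - z / latticePoint ω₁ ω₃ p.1) *
      Complex.exp (z / latticePoint ω₁ ω₃ p.1 + z ^ 2 / (2 * (latticePoint ω₁ ω₃ p.1) ^ 2))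

open Filter Topology Metric

/-- The quadratic Weierstrass factor `(1 - z/w) exp(z/w + z²/(2w²))`; it is `1` for `w = 0`. -/
noncomputable def sigmaFactor (w z : ℂ) : ℂ :=
  (1 - z / w) * Complex.exp (z / w + z ^ 2 / (2 * w ^ 2))

lemma norm_one_sub_mul_exp_sub_one_le {u : ℂ} (hu : ‖u‖ ≤ 1 / 2) :
    ‖(1 - u) * Complex.exp (u + u ^ 2 / 2) - 1‖ ≤ 2 * ‖u‖ ^ 3 := by
  set t := u + u ^ 2 / 2 with ht
  set r := Complex.exp t - (1 + t + t ^ 2 / 2) with hr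
  have hn : 0 ≤ ‖u‖ := norm_nonneg u
  have htu : ‖t‖ ≤ 5 / 4 * ‖u‖ := by
    calc ‖t‖ ≤ ‖u‖ + ‖u ^ 2 / 2‖ := norm_add_le _ _
      _ = ‖u‖ + ‖u‖ ^ 2 / 2 := by simp
      _ ≤ 5 / 4 * ‖u‖ := by nlinarith
  have hrn : ‖r‖ ≤ 1 / 2 * ‖u‖ ^ 3 := by
    have h := Complex.exp_bound (x := t) (by linarith) (n := 3) (by norm_num)
    simp only [Finset.sum_range_succ, Finset.sum_range_zero, Nat.factorial] at h
    norm_num at h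
    calc ‖r‖ ≤ ‖t‖ ^ 3 * (2 / 9) := h
      _ ≤ (5 / 4 * ‖u‖) ^ 3 * (2 / 9) := by gcongr
      _ ≤ 1 / 2 * ‖u‖ ^ 3 := by nlinarith [pow_nonneg hn 3]
  have key : (1 - u) * Complex.exp t - 1 =
      u ^ 3 * (-(1 / 2) - 3 / 8 * u - 1 / 8 * u ^ 2) + (1 - u) * r := by
    rw [hr, ht]; ring
  have h1 : ‖-(1 / 2) - 3 / 8 * u - 1 / 8 * u ^ 2‖ ≤ 1 := by
    calc ‖-(1 / 2) - 3 / 8 * u - 1 / 8 * u ^ 2‖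
        ≤ ‖(-(1 / 2) : ℂ)‖ + ‖3 / 8 * u‖ + ‖1 / 8 * u ^ 2‖ :=
          (norm_sub_le _ _).trans (by gcongr; exact norm_sub_le _ _)
      _ = 1 / 2 + 3 / 8 * ‖u‖ + 1 / 8 * ‖u‖ ^ 2 := by norm_num
      _ ≤ 1 := by nlinarith
  have h2 : ‖1 - u‖ ≤ 2 := by
    calc ‖1 - u‖ ≤ ‖(1 : ℂ)‖ + ‖u‖ := norm_sub_le _ _
      _ ≤ 2 := by norm_num; linarith
  rw [key]
  calc ‖u ^ 3 * (-(1 / 2) - 3 / 8 * u - 1 / 8 * u ^ 2) + (1 - u) * r‖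
      ≤ ‖u‖ ^ 3 * ‖-(1 / 2) - 3 / 8 * u - 1 / 8 * u ^ 2‖ + ‖1 - u‖ * ‖r‖ := by
        rw [← norm_pow, ← norm_mul, ← norm_mul]
        exact norm_add_le _ _
    _ ≤ ‖u‖ ^ 3 * 1 + 2 * (1 / 2 * ‖u‖ ^ 3) := by gcongr
    _ = 2 * ‖u‖ ^ 3 := by ring

lemma norm_sigmaFactor_sub_one_le {w z : ℂ} {R : ℝ} (hz : ‖z‖ ≤ R) (hw : 2 * R ≤ ‖w‖) :
    ‖sigmaFactor w z - 1‖ ≤ 2 * R ^ 3 * (‖w‖ ^ 3)⁻¹ := by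
  have hR : 0 ≤ R := (norm_nonneg z).trans hz
  rcases eq_or_ne w 0 with rfl | hw0
  · simp [sigmaFactor]
  have hwpos : 0 < ‖w‖ := norm_pos_iff.mpr hw0
  have hu : ‖z / w‖ ≤ 1 / 2 := by
    rw [norm_div, div_le_iff₀ hwpos]; linarith
  have h := norm_one_sub_mul_exp_sub_one_le hu
  rw [show z / w + (z / w) ^ 2 / 2 = z / w + z ^ 2 / (2 * w ^ 2) by field_simp] at h
  refine h.trans ?_
  rw [norm_div, div_pow, div_eq_mul_inv, ← mul_assoc]
  gcongr

lemma sigmaFactor_zero (w : ℂ) : sigmaFactor w 0 = 1 := by simp [sigmaFactor]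

lemma zero_sigmaFactor (z : ℂ) : sigmaFactor 0 z = 1 := by simp [sigmaFactor]

lemma sigmaFactor_neg_neg (w z : ℂ) : sigmaFactor (-w) (-z) = sigmaFactor w z := by
  simp [sigmaFactor]

lemma sigmaFactor_eq_zero_iff {w z : ℂ} : sigmaFactor w z = 0 ↔ w ≠ 0 ∧ z = w := by
  rcases eq_or_ne w 0 with rfl | hw
  · simp [sigmaFactor]
  · rw [sigmaFactor, mul_eq_zero_iff_right (Complex.exp_ne_zero _), sub_eq_zero, eq_div_iff hw]
    simp [hw, eq_comm]

lemma differentiable_sigmaFactor (w : ℂ) : Differentiable ℂ (sigmaFactor w) := by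
  unfold sigmaFactor
  fun_prop

lemma latticePoint_zero (ω₁ ω₃ : ℂ) : latticePoint ω₁ ω₃ 0 = 0 := by simp [latticePoint]

lemma latticePoint_add (ω₁ ω₃ : ℂ) (p q : ℤ × ℤ) :
    latticePoint ω₁ ω₃ (p + q) = latticePoint ω₁ ω₃ p + latticePoint ω₁ ω₃ q := by
  simp [latticePoint]; ring

lemma latticePoint_neg (ω₁ ω₃ : ℂ) (p : ℤ × ℤ) :
    latticePoint ω₁ ω₃ (-p) = -latticePoint ω₁ ω₃ p := by
  simp [latticePoint]; ring

lemma linearIndependent_of_im_div_pos {ω₁ ω₃ : ℂ} (hIm : 0 < (ω₃ / ω₁).im) :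
    LinearIndependent ℝ ![2 * ω₁, 2 * ω₃] := by
  have hω₁ : ω₁ ≠ 0 := by rintro rfl; simp at hIm
  rw [LinearIndependent.pair_iff]
  intro s t h
  have h' : (s : ℂ) + t * (ω₃ / ω₁) = 0 := by
    simp only [Complex.real_smul] at h
    field_simp
    linear_combination h / 2
  have ht : t = 0 := by
    have := congrArg Complex.im h'
    simpa [hIm.ne'] using this
  refine ⟨?_, ht⟩
  simpa [ht] using h'

/-- The pair of periods `2ω₁, 2ω₃`. -/
noncomputable def fullPeriods {ω₁ ω₃ : ℂ} (hIm : 0 < (ω₃ / ω₁).im) : PeriodPair where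
  ω₁ := 2 * ω₁
  ω₂ := 2 * ω₃
  indep := linearIndependent_of_im_div_pos hIm

lemma latticeEquivProd_symm_fullPeriods {ω₁ ω₃ : ℂ} (hIm : 0 < (ω₃ / ω₁).im) (p : ℤ × ℤ) :
    ((fullPeriods hIm).latticeEquivProd.symm p : ℂ) = latticePoint ω₁ ω₃ p := by
  rw [PeriodPair.latticeEquiv_symm_apply]
  simp [latticePoint, fullPeriods]; ring

lemma summable_norm_latticePoint_pow_inv {ω₁ ω₃ : ℂ} (hIm : 0 < (ω₃ / ω₁).im) :
    Summable fun p ↦ (‖latticePoint ω₁ ω₃ p‖ ^ 3)⁻¹ := by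
  have h : Summable fun z : (fullPeriods hIm).lattice ↦ (‖z‖ ^ 3)⁻¹ := by
    simpa using ZLattice.summable_norm_pow_inv (fullPeriods hIm).lattice 3 (by simp)
  refine ((fullPeriods hIm).latticeEquivProd.symm.toEquiv.summable_iff.mpr h).congr fun p ↦ ?_
  simp [← latticeEquivProd_symm_fullPeriods hIm p]

lemma latticePoint_eq_zero_iff {ω₁ ω₃ : ℂ} (hIm : 0 < (ω₃ / ω₁).im) {p : ℤ × ℤ} :
    latticePoint ω₁ ω₃ p = 0 ↔ p = 0 := by
  rw [← latticeEquivProd_symm_fullPeriods hIm]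
  simp

lemma eventually_le_norm_latticePoint {ω₁ ω₃ : ℂ} (hIm : 0 < (ω₃ / ω₁).im) (R : ℝ) :
    ∀ᶠ p in cofinite, R ≤ ‖latticePoint ω₁ ω₃ p‖ := by
  have h := (summable_norm_latticePoint_pow_inv hIm).tendsto_cofinite_zero
  have hR : 0 < ((|R| + 1) ^ 3)⁻¹ := by positivity
  filter_upwards [h.eventually_lt_const hR, (Set.finite_singleton (0 : ℤ × ℤ)).compl_mem_cofinite]
    with p hp hp0
  have hpos : 0 < ‖latticePoint ω₁ ω₃ p‖ :=
    norm_pos_iff.mpr ((latticePoint_eq_zero_iff hIm).not.mpr hp0)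
  rw [inv_lt_inv₀ (by positivity) (by positivity)] at hp
  have := lt_of_pow_lt_pow_left₀ 3 hpos.le hp
  linarith [le_abs_self R]

lemma summable_norm_sigmaFactor_sub_one {ω₁ ω₃ : ℂ} (hIm : 0 < (ω₃ / ω₁).im) (z : ℂ) :
    Summable fun p ↦ ‖sigmaFactor (latticePoint ω₁ ω₃ p) z - 1‖ := by
  refine Summable.of_norm_bounded_eventually
    ((summable_norm_latticePoint_pow_inv hIm).mul_left (2 * ‖z‖ ^ 3)) ?_
  filter_upwards [eventually_le_norm_latticePoint hIm (2 * ‖z‖)] with p hp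
  simpa using norm_sigmaFactor_sub_one_le le_rfl hp

lemma multipliable_sigmaFactor {ω₁ ω₃ : ℂ} (hIm : 0 < (ω₃ / ω₁).im) (z : ℂ) :
    Multipliable fun p ↦ sigmaFactor (latticePoint ω₁ ω₃ p) z := by
  simpa using multipliable_one_add_of_summable (summable_norm_sigmaFactor_sub_one hIm z)

/-- The product of the Weierstrass factors over the lattice. -/
noncomputable def sigmaProd (ω₁ ω₃ z : ℂ) : ℂ :=
  ∏' p : ℤ × ℤ, sigmaFactor (latticePoint ω₁ ω₃ p) z

lemma wSigma_eq (ω₁ ω₃ z : ℂ) : wSigma ω₁ ω₃ z = z * sigmaProd ω₁ ω₃ z := by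
  unfold wSigma sigmaProd
  congr 1
  refine tprod_subtype_eq_of_mulSupport_subset
    (f := fun p ↦ sigmaFactor (latticePoint ω₁ ω₃ p) z) (s := {p | p ≠ (0, 0)}) fun p hp h0 ↦ ?_
  apply hp
  obtain rfl : p = 0 := h0
  simp [latticePoint_zero, zero_sigmaFactor]

lemma sigmaProd_zero (ω₁ ω₃ : ℂ) : sigmaProd ω₁ ω₃ 0 = 1 := by
  simp [sigmaProd, sigmaFactor_zero]

lemma sigmaProd_neg (ω₁ ω₃ z : ℂ) : sigmaProd ω₁ ω₃ (-z) = sigmaProd ω₁ ω₃ z := by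
  unfold sigmaProd
  rw [← (Equiv.neg (ℤ × ℤ)).tprod_eq]
  simp [latticePoint_neg, sigmaFactor_neg_neg]

lemma wSigma_neg (ω₁ ω₃ z : ℂ) : wSigma ω₁ ω₃ (-z) = -wSigma ω₁ ω₃ z := by
  simp [wSigma_eq, sigmaProd_neg]

lemma wSigma_zero (ω₁ ω₃ : ℂ) : wSigma ω₁ ω₃ 0 = 0 := by simp [wSigma_eq]

lemma differentiable_sigmaProd {ω₁ ω₃ : ℂ} (hIm : 0 < (ω₃ / ω₁).im) :
    Differentiable ℂ (sigmaProd ω₁ ω₃) := by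
  intro z
  set R : ℝ := ‖z‖ + 1
  have hz : z ∈ ball (0 : ℂ) R := by simp [R]
  have hprod : HasProdLocallyUniformlyOn
      (fun p x ↦ 1 + (sigmaFactor (latticePoint ω₁ ω₃ p) x - 1))
      (fun x ↦ ∏' p, (1 + (sigmaFactor (latticePoint ω₁ ω₃ p) x - 1))) (ball (0 : ℂ) R) := by
    refine ((summable_norm_latticePoint_pow_inv hIm).mul_left
      (2 * R ^ 3)).hasProdLocallyUniformlyOn_one_add isOpen_ball ?_
      fun p ↦ ((differentiable_sigmaFactor _).continuous.sub continuous_const).continuousOn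
    filter_upwards [eventually_le_norm_latticePoint hIm (2 * R)] with p hp x hx
    exact norm_sigmaFactor_sub_one_le (by simpa using (mem_ball_zero_iff.mp hx).le) hp
  simp only [add_sub_cancel] at hprod
  have hd := (hasProdLocallyUniformlyOn_iff_tendstoLocallyUniformlyOn.mp hprod).differentiableOn
    (Eventually.of_forall fun s ↦ ?_) isOpen_ball
  · exact (hd z hz).differentiableAt (isOpen_ball.mem_nhds hz)
  · exact DifferentiableOn.fun_finsetProd fun p _ ↦ (differentiable_sigmaFactor _).differentiableOn

lemma differentiable_wSigma {ω₁ ω₃ : ℂ} (hIm : 0 < (ω₃ / ω₁).im) :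
    Differentiable ℂ (wSigma ω₁ ω₃) := by
  rw [show wSigma ω₁ ω₃ = fun z ↦ z * sigmaProd ω₁ ω₃ z from funext (wSigma_eq ω₁ ω₃)]
  exact differentiable_id.mul (differentiable_sigmaProd hIm)

lemma wSigma_eq_zero_iff {ω₁ ω₃ : ℂ} (hIm : 0 < (ω₃ / ω₁).im) {z : ℂ} :
    wSigma ω₁ ω₃ z = 0 ↔ z ∈ Set.range (latticePoint ω₁ ω₃) := by
  rw [wSigma_eq]
  constructor
  · intro h
    by_contra! hz
    have hz0 : z ≠ 0 := fun h0 ↦ hz ⟨0, by rw [latticePoint_zero, h0]⟩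
    refine (mul_ne_zero hz0 ?_) h
    have := tprod_one_add_ne_zero_of_summable
      (f := fun p ↦ sigmaFactor (latticePoint ω₁ ω₃ p) z - 1) (fun p ↦ ?_)
      (summable_norm_sigmaFactor_sub_one hIm z)
    · simpa [sigmaProd] using this
    · rw [add_sub_cancel, Ne, sigmaFactor_eq_zero_iff]
      exact fun hp ↦ hz ⟨p, hp.2.symm⟩
  · rintro ⟨p, rfl⟩
    by_cases hp : latticePoint ω₁ ω₃ p = 0
    · simp [hp]
    · rw [sigmaProd, tprod_of_exists_eq_zero ⟨p, sigmaFactor_eq_zero_iff.mpr ⟨hp, rfl⟩⟩, mul_zero]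

lemma wSigma_add_latticePoint_eq_zero_iff {ω₁ ω₃ : ℂ} (hIm : 0 < (ω₃ / ω₁).im) (z : ℂ)
    (q : ℤ × ℤ) : wSigma ω₁ ω₃ (z + latticePoint ω₁ ω₃ q) = 0 ↔ wSigma ω₁ ω₃ z = 0 := by
  rw [wSigma_eq_zero_iff hIm, wSigma_eq_zero_iff hIm]
  constructor
  · rintro ⟨p, hp⟩
    exact ⟨p + -q, by rw [latticePoint_add, latticePoint_neg, hp]; ring⟩
  · rintro ⟨p, hp⟩
    exact ⟨p + q, by rw [latticePoint_add, hp]⟩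

/-- The product `σ(z + u) σ(z - u)`. -/
noncomputable def sigmaPair (ω₁ ω₃ u z : ℂ) : ℂ := wSigma ω₁ ω₃ (z + u) * wSigma ω₁ ω₃ (z - u)

lemma sigmaPair_neg (ω₁ ω₃ u z : ℂ) : sigmaPair ω₁ ω₃ u (-z) = sigmaPair ω₁ ω₃ u z := by
  rw [sigmaPair, sigmaPair, show -z + u = -(z - u) by ring, show -z - u = -(z + u) by ring,
    wSigma_neg, wSigma_neg]
  ring

lemma sigmaPair_swap (ω₁ ω₃ u z : ℂ) : sigmaPair ω₁ ω₃ z u = -sigmaPair ω₁ ω₃ u z := by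
  rw [sigmaPair, sigmaPair, show u - z = -(z - u) by ring, wSigma_neg, add_comm u z]
  ring

lemma sigmaPair_self (ω₁ ω₃ u : ℂ) : sigmaPair ω₁ ω₃ u u = 0 := by
  simp [sigmaPair, wSigma_zero]

lemma differentiable_sigmaPair {ω₁ ω₃ : ℂ} (hIm : 0 < (ω₃ / ω₁).im) (u : ℂ) :
    Differentiable ℂ (sigmaPair ω₁ ω₃ u) :=
  ((differentiable_wSigma hIm).comp (differentiable_id.add_const u)).mul
    ((differentiable_wSigma hIm).comp (differentiable_id.sub_const u))

lemma sigmaPair_add_latticePoint_eq_zero_iff {ω₁ ω₃ : ℂ} (hIm : 0 < (ω₃ / ω₁).im) (u z : ℂ)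
    (q : ℤ × ℤ) :
    sigmaPair ω₁ ω₃ u (z + latticePoint ω₁ ω₃ q) = 0 ↔ sigmaPair ω₁ ω₃ u z = 0 := by
  rw [sigmaPair, sigmaPair, mul_eq_zero, mul_eq_zero, add_right_comm, add_sub_right_comm,
    wSigma_add_latticePoint_eq_zero_iff hIm, wSigma_add_latticePoint_eq_zero_iff hIm]

lemma sigmaFactor_quotient {w : ℂ} (hw : w ≠ 0) (u v z : ℂ) :
    sigmaFactor w (z + u) * sigmaFactor w (z - u) /
        (sigmaFactor w (z + v) * sigmaFactor w (z - v)) =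
      ((w - z) ^ 2 - u ^ 2) / ((w - z) ^ 2 - v ^ 2) * Complex.exp ((u ^ 2 - v ^ 2) / w ^ 2) := by
  have hexp : Complex.exp ((z + u) / w + (z + u) ^ 2 / (2 * w ^ 2)) *
      Complex.exp ((z - u) / w + (z - u) ^ 2 / (2 * w ^ 2)) =
      Complex.exp ((u ^ 2 - v ^ 2) / w ^ 2) *
        (Complex.exp ((z + v) / w + (z + v) ^ 2 / (2 * w ^ 2)) *
      Complex.exp ((z - v) / w + (z - v) ^ 2 / (2 * w ^ 2))) := by
    simp only [← Complex.exp_add]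
    congr 1
    field_simp
    ring
  have hnum (t : ℂ) : (w - z) ^ 2 - t ^ 2 = w ^ 2 * ((1 - (z + t) / w) * (1 - (z - t) / w)) := by
    field_simp
    ring
  rw [hnum u, hnum v, mul_div_mul_left _ _ (pow_ne_zero 2 hw)]
  simp only [sigmaFactor]
  rw [mul_mul_mul_comm, hexp, mul_mul_mul_comm (1 - (z + v) / w), mul_div_mul_comm,
    mul_div_cancel_right₀ _ (by simp [Complex.exp_ne_zero])]

lemma hasProd_sigmaPair_div_sigmaPair {ω₁ ω₃ : ℂ} (hIm : 0 < (ω₃ / ω₁).im) (u : ℂ) {v z : ℂ}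
    (hv : sigmaPair ω₁ ω₃ v z ≠ 0) :
    HasProd (fun p ↦ ((latticePoint ω₁ ω₃ p - z) ^ 2 - u ^ 2) /
        ((latticePoint ω₁ ω₃ p - z) ^ 2 - v ^ 2) *
          Complex.exp ((u ^ 2 - v ^ 2) / latticePoint ω₁ ω₃ p ^ 2))
      (sigmaPair ω₁ ω₃ u z / sigmaPair ω₁ ω₃ v z) := by
  have hP (t : ℂ) : HasProd (fun p ↦ sigmaFactor (latticePoint ω₁ ω₃ p) t) (sigmaProd ω₁ ω₃ t) :=
    (multipliable_sigmaFactor hIm t).hasProd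
  have hv' : sigmaProd ω₁ ω₃ (z + v) * sigmaProd ω₁ ω₃ (z - v) ≠ 0 := by
    simp only [sigmaPair, wSigma_eq] at hv
    simp only [ne_eq, mul_eq_zero, not_or] at hv ⊢
    exact ⟨hv.1.2, hv.2.2⟩
  have h := (hasProd_ite_eq (0 : ℤ × ℤ) ((z + u) * (z - u) / ((z + v) * (z - v)))).mul
    (((hP (z + u)).mul (hP (z - u))).div₀ ((hP (z + v)).mul (hP (z - v))) hv')
  convert! h using 1
  · ext p
    split_ifs with hp
    · subst hp
      simp only [latticePoint_zero, zero_sigmaFactor]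
      norm_num
      ring_nf
    · rw [one_mul, sigmaFactor_quotient ((latticePoint_eq_zero_iff hIm).not.mpr hp)]
  · simp only [sigmaPair, wSigma_eq]
    rw [mul_mul_mul_comm, mul_mul_mul_comm (z + v), mul_div_mul_comm]

lemma hasProd_exp_shift {ω₁ ω₃ : ℂ} (hIm : 0 < (ω₃ / ω₁).im) {u v z : ℂ} (q : ℤ × ℤ)
    (hu : sigmaPair ω₁ ω₃ u z ≠ 0) (hv : sigmaPair ω₁ ω₃ v z ≠ 0) :
    HasProd (fun p ↦ Complex.exp ((u ^ 2 - v ^ 2) / latticePoint ω₁ ω₃ (p + q) ^ 2) /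
        Complex.exp ((u ^ 2 - v ^ 2) / latticePoint ω₁ ω₃ p ^ 2))
      (sigmaPair ω₁ ω₃ u (z + latticePoint ω₁ ω₃ q) /
        sigmaPair ω₁ ω₃ v (z + latticePoint ω₁ ω₃ q) /
          (sigmaPair ω₁ ω₃ u z / sigmaPair ω₁ ω₃ v z)) := by
  have hv' := (sigmaPair_add_latticePoint_eq_zero_iff hIm v z q).not.mpr hv
  have h1 := (Equiv.addRight q).hasProd_iff.mpr (hasProd_sigmaPair_div_sigmaPair hIm u hv')
  have h2 := hasProd_sigmaPair_div_sigmaPair hIm u hv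
  have h := h1.div₀ h2 (div_ne_zero hu hv)
  have hne (t : ℂ) (ht : sigmaPair ω₁ ω₃ t z ≠ 0) (p : ℤ × ℤ) :
      (latticePoint ω₁ ω₃ p - z) ^ 2 - t ^ 2 ≠ 0 := by
    intro h0
    have h0' : (latticePoint ω₁ ω₃ p - (z + t)) * (latticePoint ω₁ ω₃ p - (z - t)) = 0 := by
      linear_combination h0
    apply ht
    rw [sigmaPair, mul_eq_zero, wSigma_eq_zero_iff hIm, wSigma_eq_zero_iff hIm]
    exact (mul_eq_zero.mp h0').imp (fun h ↦ ⟨p, sub_eq_zero.mp h⟩) fun h ↦ ⟨p, sub_eq_zero.mp h⟩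
  convert! h using 1
  ext p
  simp only [Function.comp_apply, Equiv.coe_addRight]
  rw [show latticePoint ω₁ ω₃ (p + q) - (z + latticePoint ω₁ ω₃ q) = latticePoint ω₁ ω₃ p - z by
    rw [latticePoint_add]; ring, mul_div_mul_left _ _ (div_ne_zero (hne u hu p) (hne v hv p))]

/-- `σ(z + u) σ(z - u) / (σ(z + v) σ(z - v))` is an elliptic function of `z`. -/
lemma sigmaPair_div_sigmaPair_add_latticePoint {ω₁ ω₃ : ℂ} (hIm : 0 < (ω₃ / ω₁).im) {u v : ℂ}
    (hu : wSigma ω₁ ω₃ (2 * u) ≠ 0) (hv : wSigma ω₁ ω₃ (2 * v) ≠ 0) (z : ℂ) (q : ℤ × ℤ) :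
    sigmaPair ω₁ ω₃ u (z + latticePoint ω₁ ω₃ q) / sigmaPair ω₁ ω₃ v (z + latticePoint ω₁ ω₃ q) =
      sigmaPair ω₁ ω₃ u z / sigmaPair ω₁ ω₃ v z := by
  by_cases hvz : sigmaPair ω₁ ω₃ v z = 0
  · rw [hvz, (sigmaPair_add_latticePoint_eq_zero_iff hIm v z q).mpr hvz, div_zero, div_zero]
  by_cases huz : sigmaPair ω₁ ω₃ u z = 0
  · rw [huz, (sigmaPair_add_latticePoint_eq_zero_iff hIm u z q).mpr huz, zero_div, zero_div]
  set l := latticePoint ω₁ ω₃ q with hl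
  have hhalf (t : ℂ) (ht : wSigma ω₁ ω₃ (2 * t) ≠ 0) : sigmaPair ω₁ ω₃ t (-(l / 2)) ≠ 0 := by
    contrapose! ht
    rw [sigmaPair, mul_eq_zero, wSigma_eq_zero_iff hIm, wSigma_eq_zero_iff hIm] at ht
    rw [wSigma_eq_zero_iff hIm]
    obtain ⟨p, hp⟩ | ⟨p, hp⟩ := ht
    · exact ⟨p + p + q, by rw [latticePoint_add, latticePoint_add, hp]; ring⟩
    · exact ⟨-(p + p + q), by
        rw [latticePoint_neg, latticePoint_add, latticePoint_add, hp]; ring⟩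
  have h := (hasProd_exp_shift hIm q huz hvz).unique
    (hasProd_exp_shift hIm q (hhalf u hu) (hhalf v hv))
  rw [← hl, show -(l / 2) + l = l / 2 by ring, sigmaPair_neg, sigmaPair_neg,
    div_self (by
      rw [← sigmaPair_neg _ _ u, ← sigmaPair_neg _ _ v]
      exact div_ne_zero (hhalf u hu) (hhalf v hv)),
    div_eq_one_iff_eq (div_ne_zero huz hvz)] at h
  exact h

lemma exists_differentiable_of_eventuallyEq_analyticAt {q : ℂ → ℂ}
    (hq : ∀ x, ∃ h, AnalyticAt ℂ h x ∧ q =ᶠ[𝓝[≠] x] h) :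
    ∃ Q, Differentiable ℂ Q ∧ ∀ x, q =ᶠ[𝓝[≠] x] Q := by
  choose h hh hqh using hq
  have key (x : ℂ) : (fun y ↦ h y y) =ᶠ[𝓝[≠] x] h x := by
    filter_upwards [eventually_eventually_nhdsWithin.mpr (hqh x), self_mem_nhdsWithin,
      (hh x).eventually_analyticAt.filter_mono nhdsWithin_le_nhds] with y hy hyx hay
    have hyx' : ({x}ᶜ : Set ℂ) ∈ 𝓝 y := isOpen_compl_singleton.mem_nhds hyx
    rw [nhdsWithin_eq_nhds.mpr hyx'] at hy
    have h1 : Tendsto (h y) (𝓝[≠] y) (𝓝 (h y y)) :=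
      (hh y).continuousAt.tendsto.mono_left nhdsWithin_le_nhds
    have h2 : Tendsto (h x) (𝓝[≠] y) (𝓝 (h x y)) :=
      hay.continuousAt.tendsto.mono_left nhdsWithin_le_nhds
    exact tendsto_nhds_unique_of_eventuallyEq h1 h2
      ((hqh y).symm.trans (hy.filter_mono nhdsWithin_le_nhds))
  refine ⟨fun y ↦ h y y, fun x ↦ ?_, fun x ↦ (hqh x).trans (key x).symm⟩
  have : (fun y ↦ h y y) =ᶠ[𝓝 x] h x := eventuallyEq_nhds_of_eventuallyEq_nhdsNE (key x) rfl
  exact ((hh x).congr this.symm).differentiableAt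

lemma exists_latticePoint_add_mem_parallelogram {ω₁ ω₃ : ℂ} (hIm : 0 < (ω₃ / ω₁).im) (x : ℂ) :
    ∃ q : ℤ × ℤ, ∃ s ∈ Set.Icc (0 : ℝ) 1, ∃ t ∈ Set.Icc (0 : ℝ) 1,
      x = s * (2 * ω₁) + t * (2 * ω₃) + latticePoint ω₁ ω₃ q := by
  set L := fullPeriods hIm
  have hx := L.basis.sum_repr x
  simp only [Fin.sum_univ_two, PeriodPair.basis_zero, PeriodPair.basis_one,
    Complex.real_smul] at hx
  set s := L.basis.repr x 0
  set t := L.basis.repr x 1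
  refine ⟨(⌊s⌋, ⌊t⌋), Int.fract s, ⟨Int.fract_nonneg _, (Int.fract_lt_one _).le⟩, Int.fract t,
    ⟨Int.fract_nonneg _, (Int.fract_lt_one _).le⟩, ?_⟩
  rw [← hx]
  simp only [latticePoint, Int.fract, L, fullPeriods]
  push_cast
  ring

lemma eq_of_differentiable_of_lattice_periodic {ω₁ ω₃ : ℂ} (hIm : 0 < (ω₃ / ω₁).im) {Q : ℂ → ℂ}
    (hd : Differentiable ℂ Q) (hp : ∀ x q, Q (x + latticePoint ω₁ ω₃ q) = Q x) (x y : ℂ) :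
    Q x = Q y := by
  refine hd.apply_eq_apply_of_bounded ?_ x y
  have hcomp : IsCompact ((fun st : ℝ × ℝ ↦ Q (st.1 * (2 * ω₁) + st.2 * (2 * ω₃))) ''
      (Set.Icc 0 1 ×ˢ Set.Icc 0 1)) := by
    refine (isCompact_Icc.prod isCompact_Icc).image (hd.continuous.comp ?_)
    fun_prop
  refine hcomp.isBounded.subset ?_
  rintro _ ⟨x, rfl⟩
  obtain ⟨q, s, hs, t, ht, rfl⟩ := exists_latticePoint_add_mem_parallelogram hIm x
  exact ⟨(s, t), ⟨hs, ht⟩, (hp _ q).symm⟩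

lemma tendsto_add_const_nhdsNE (x l : ℂ) : Tendsto (· + l) (𝓝[≠] x) (𝓝[≠] (x + l)) :=
  ((continuous_add_const l).continuousWithinAt).tendsto_nhdsWithin fun y hy ↦ by simpa using hy

lemma tendsto_neg_nhdsNE (x : ℂ) : Tendsto (- ·) (𝓝[≠] x) (𝓝[≠] (-x)) :=
  (continuous_neg.continuousWithinAt).tendsto_nhdsWithin fun y hy ↦ by simpa using hy

lemma eq_of_lattice_periodic_of_eventuallyEq_analyticAt {ω₁ ω₃ : ℂ} (hIm : 0 < (ω₃ / ω₁).im)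
    {q : ℂ → ℂ} (hq : ∀ x, ∃ h, AnalyticAt ℂ h x ∧ q =ᶠ[𝓝[≠] x] h)
    (hp : ∀ x p, q (x + latticePoint ω₁ ω₃ p) = q x) {x y : ℂ} (hx : ContinuousAt q x)
    (hy : ContinuousAt q y) : q x = q y := by
  obtain ⟨Q, hQ, hqQ⟩ := exists_differentiable_of_eventuallyEq_analyticAt hq
  have hlim (x : ℂ) : Tendsto q (𝓝[≠] x) (𝓝 (Q x)) :=
    (hQ.continuous.continuousAt.tendsto.mono_left nhdsWithin_le_nhds).congr' (hqQ x).symm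
  have hper (x : ℂ) (p : ℤ × ℤ) : Q (x + latticePoint ω₁ ω₃ p) = Q x := by
    refine tendsto_nhds_unique ?_ (hlim x)
    exact ((hlim (x + latticePoint ω₁ ω₃ p)).comp (tendsto_add_const_nhdsNE x _)).congr
      fun y ↦ hp y p
  have hval {x : ℂ} (hx : ContinuousAt q x) : q x = Q x :=
    tendsto_nhds_unique (hx.tendsto.mono_left nhdsWithin_le_nhds) (hlim x)
  rw [hval hx, hval hy]
  exact eq_of_differentiable_of_lattice_periodic hIm hQ hper x y

lemma sigmaPair_eq_zero_iff {ω₁ ω₃ : ℂ} (hIm : 0 < (ω₃ / ω₁).im) {u z : ℂ} :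
    sigmaPair ω₁ ω₃ u z = 0 ↔
      ∃ p, z = u + latticePoint ω₁ ω₃ p ∨ z = -u + latticePoint ω₁ ω₃ p := by
  rw [sigmaPair, mul_eq_zero, wSigma_eq_zero_iff hIm, wSigma_eq_zero_iff hIm]
  constructor
  · rintro (⟨p, hp⟩ | ⟨p, hp⟩)
    · exact ⟨p, .inr (by rw [hp]; ring)⟩
    · exact ⟨p, .inl (by rw [hp]; ring)⟩
  · rintro ⟨p, rfl | rfl⟩
    · exact .inr ⟨p, by ring⟩
    · exact .inl ⟨p, by ring⟩

/-- Quotients by `σ(x + y) σ(x - y)` have removable singularities when they are even and elliptic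
and their numerator vanishes at `y`. -/
lemma exists_analyticAt_eventuallyEq_div_sigmaPair {ω₁ ω₃ : ℂ} (hIm : 0 < (ω₃ / ω₁).im)
    {f : ℂ → ℂ} (hf : Differentiable ℂ f) {y : ℂ} (hy : wSigma ω₁ ω₃ (2 * y) ≠ 0) (hfy : f y = 0)
    (heven : ∀ x, f (-x) = f x)
    (hper : ∀ x p, f (x + latticePoint ω₁ ω₃ p) / sigmaPair ω₁ ω₃ y (x + latticePoint ω₁ ω₃ p) =
      f x / sigmaPair ω₁ ω₃ y x) (x : ℂ) :
    ∃ h, AnalyticAt ℂ h x ∧ (fun x ↦ f x / sigmaPair ω₁ ω₃ y x) =ᶠ[𝓝[≠] x] h := by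
  have hTd := differentiable_sigmaPair hIm y
  by_cases hx : sigmaPair ω₁ ω₃ y x = 0
  swap
  · exact ⟨_, (hf.analyticAt x).fun_div (hTd.analyticAt x) hx, EventuallyEq.rfl⟩
  have hat : ∃ h, AnalyticAt ℂ h y ∧ (fun x ↦ f x / sigmaPair ω₁ ω₃ y x) =ᶠ[𝓝[≠] y] h := by
    refine ⟨fun x ↦ dslope f y x / (wSigma ω₁ ω₃ (x + y) * sigmaProd ω₁ ω₃ (x - y)), ?_, ?_⟩
    · have hds : Differentiable ℂ (dslope f y) := by
        rw [← differentiableOn_univ]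
        exact (Complex.differentiableOn_dslope univ_mem).mpr hf.differentiableOn
      have hg : Differentiable ℂ fun x ↦ wSigma ω₁ ω₃ (x + y) * sigmaProd ω₁ ω₃ (x - y) :=
        ((differentiable_wSigma hIm).comp (differentiable_id.add_const y)).mul
          ((differentiable_sigmaProd hIm).comp (differentiable_id.sub_const y))
      refine (hds.analyticAt y).fun_div (hg.analyticAt y) ?_
      rwa [sub_self, sigmaProd_zero, mul_one, ← two_mul]
    · filter_upwards [self_mem_nhdsWithin] with x hxy
      rw [dslope_of_ne _ hxy, slope_def_field, hfy, sub_zero, sigmaPair, wSigma_eq _ _ (x - y),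
        div_div]
      ring
  have hshift {x₀ : ℂ} (p : ℤ × ℤ)
      (h0 : ∃ h, AnalyticAt ℂ h x₀ ∧ (fun x ↦ f x / sigmaPair ω₁ ω₃ y x) =ᶠ[𝓝[≠] x₀] h) :
      ∃ h, AnalyticAt ℂ h (x₀ + latticePoint ω₁ ω₃ p) ∧
        (fun x ↦ f x / sigmaPair ω₁ ω₃ y x) =ᶠ[𝓝[≠] (x₀ + latticePoint ω₁ ω₃ p)] h := by
    obtain ⟨h, hh, hq⟩ := h0
    set l := latticePoint ω₁ ω₃ p with hl
    have hx₀ : x₀ + l + -l = x₀ := by ring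
    refine ⟨fun x ↦ h (x + -l), ?_, ?_⟩
    · exact AnalyticAt.comp (g := h) (by rwa [hx₀]) (analyticAt_id.add analyticAt_const)
    · have ht := tendsto_add_const_nhdsNE (x₀ + l) (-l)
      rw [hx₀] at ht
      filter_upwards [ht.eventually hq] with x hx
      rw [← hx, ← hper (x + -l) p, ← hl, neg_add_cancel_right]
  obtain ⟨p, rfl | rfl⟩ := (sigmaPair_eq_zero_iff hIm).mp hx
  · exact hshift p hat
  · apply hshift p
    obtain ⟨h, hh, hq⟩ := hat
    refine ⟨fun x ↦ h (-x), ?_, ?_⟩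
    · exact AnalyticAt.comp (g := h) (by rwa [neg_neg]) analyticAt_id.neg
    · have ht := tendsto_neg_nhdsNE (-y)
      rw [neg_neg] at ht
      filter_upwards [ht.eventually hq] with x hx
      rw [← hx, heven, sigmaPair_neg]

lemma sigmaPair_three_term_of_ne_zero {ω₁ ω₃ : ℂ} (hIm : 0 < (ω₃ / ω₁).im) {x y z w : ℂ}
    (hy : wSigma ω₁ ω₃ (2 * y) ≠ 0) (hz : wSigma ω₁ ω₃ (2 * z) ≠ 0)
    (hw : wSigma ω₁ ω₃ (2 * w) ≠ 0) (hyz : sigmaPair ω₁ ω₃ y z ≠ 0)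
    (hyx : sigmaPair ω₁ ω₃ y x ≠ 0) :
    sigmaPair ω₁ ω₃ w z * sigmaPair ω₁ ω₃ y x + sigmaPair ω₁ ω₃ y w * sigmaPair ω₁ ω₃ z x +
      sigmaPair ω₁ ω₃ z y * sigmaPair ω₁ ω₃ w x = 0 := by
  set f : ℂ → ℂ := fun x ↦ sigmaPair ω₁ ω₃ w z * sigmaPair ω₁ ω₃ y x +
    sigmaPair ω₁ ω₃ y w * sigmaPair ω₁ ω₃ z x + sigmaPair ω₁ ω₃ z y * sigmaPair ω₁ ω₃ w x with hf
  have hfd : Differentiable ℂ f :=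
    (((differentiable_sigmaPair hIm y).const_mul _).add
      ((differentiable_sigmaPair hIm z).const_mul _)).add
        ((differentiable_sigmaPair hIm w).const_mul _)
  have hfy : f y = 0 := by
    simp only [hf, sigmaPair_self, sigmaPair_swap ω₁ ω₃ w y]
    ring
  have hfz : f z = 0 := by
    simp only [hf, sigmaPair_self, sigmaPair_swap ω₁ ω₃ y z]
    ring
  have heven (x : ℂ) : f (-x) = f x := by simp only [hf, sigmaPair_neg]
  have hper (x : ℂ) (p : ℤ × ℤ) : f (x + latticePoint ω₁ ω₃ p) /
      sigmaPair ω₁ ω₃ y (x + latticePoint ω₁ ω₃ p) = f x / sigmaPair ω₁ ω₃ y x := by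
    simp only [hf, add_div, mul_div_assoc, sigmaPair_div_sigmaPair_add_latticePoint hIm hy hy,
      sigmaPair_div_sigmaPair_add_latticePoint hIm hz hy,
      sigmaPair_div_sigmaPair_add_latticePoint hIm hw hy]
  have hcont {x : ℂ} (hx : sigmaPair ω₁ ω₃ y x ≠ 0) :
      ContinuousAt (fun x ↦ f x / sigmaPair ω₁ ω₃ y x) x :=
    hfd.continuous.continuousAt.div (differentiable_sigmaPair hIm y).continuous.continuousAt hx
  have h := eq_of_lattice_periodic_of_eventuallyEq_analyticAt hIm
    (exists_analyticAt_eventuallyEq_div_sigmaPair hIm hfd hy hfy heven hper) hper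
    (hcont hyx) (hcont hyz)
  rw [hfz, zero_div] at h
  exact (div_eq_zero_iff.mp h).resolve_right hyx

lemma dense_wSigma_ne_zero {ω₁ ω₃ : ℂ} (hIm : 0 < (ω₃ / ω₁).im) :
    Dense {z | wSigma ω₁ ω₃ z ≠ 0} := by
  have h : {z | wSigma ω₁ ω₃ z ≠ 0} = (Set.range (latticePoint ω₁ ω₃))ᶜ := by
    ext z
    exact (wSigma_eq_zero_iff hIm).not
  rw [h]
  exact (Set.countable_range _).dense_compl ℂ

lemma dense_wSigma_two_mul_ne_zero {ω₁ ω₃ : ℂ} (hIm : 0 < (ω₃ / ω₁).im) :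
    Dense {z | wSigma ω₁ ω₃ (2 * z) ≠ 0} :=
  (dense_wSigma_ne_zero hIm).preimage (Homeomorph.mulLeft₀ (2 : ℂ) two_ne_zero).isOpenMap

lemma dense_sigmaPair_ne_zero {ω₁ ω₃ : ℂ} (hIm : 0 < (ω₃ / ω₁).im) (u : ℂ) :
    Dense {z | sigmaPair ω₁ ω₃ u z ≠ 0} := by
  have h : {z | sigmaPair ω₁ ω₃ u z ≠ 0} =
      (Set.range (fun p ↦ u + latticePoint ω₁ ω₃ p) ∪
        Set.range (fun p ↦ -u + latticePoint ω₁ ω₃ p))ᶜ := by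
    ext z
    rw [Set.mem_compl_iff, Set.mem_ofPred_eq, Ne, sigmaPair_eq_zero_iff hIm]
    simp only [exists_or, Set.mem_union, Set.mem_range, eq_comm]
  rw [h]
  exact ((Set.countable_range _).union (Set.countable_range _)).dense_compl ℂ

lemma sigmaPair_three_term {ω₁ ω₃ : ℂ} (hIm : 0 < (ω₃ / ω₁).im) (x y z w : ℂ) :
    sigmaPair ω₁ ω₃ w z * sigmaPair ω₁ ω₃ y x + sigmaPair ω₁ ω₃ y w * sigmaPair ω₁ ω₃ z x +
      sigmaPair ω₁ ω₃ z y * sigmaPair ω₁ ω₃ w x = 0 := by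
  have hc := (differentiable_wSigma hIm).continuous
  have hext {g : ℂ → ℂ} {s : Set ℂ} (hs : Dense s) (hg : Continuous g) (h : ∀ t ∈ s, g t = 0)
      (t : ℂ) : g t = 0 :=
    congrFun (Continuous.ext_on hs hg continuous_const h) t
  have hopen : IsOpen {t | wSigma ω₁ ω₃ (2 * t) ≠ 0} :=
    isOpen_ne_fun (hc.comp (continuous_const_mul 2)) continuous_const
  have h2 := dense_wSigma_two_mul_ne_zero hIm
  have hs {f g : ℂ → ℂ} (hf : Continuous f) (hg : Continuous g) :
      Continuous fun t ↦ sigmaPair ω₁ ω₃ (f t) (g t) := by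
    simp only [sigmaPair]
    fun_prop
  have hG {p q r s : ℂ → ℂ} (hp : Continuous p) (hq : Continuous q) (hr : Continuous r)
      (hs' : Continuous s) : Continuous fun t ↦
      sigmaPair ω₁ ω₃ (s t) (r t) * sigmaPair ω₁ ω₃ (q t) (p t) +
      sigmaPair ω₁ ω₃ (q t) (s t) * sigmaPair ω₁ ω₃ (r t) (p t) +
      sigmaPair ω₁ ω₃ (r t) (q t) * sigmaPair ω₁ ω₃ (s t) (p t) :=
    (((hs hs' hr).mul (hs hq hp)).add ((hs hq hs').mul (hs hr hp))).add
      ((hs hr hq).mul (hs hs' hp))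
  refine hext h2 (hG continuous_const continuous_id continuous_const continuous_const)
    (fun y hy ↦ ?_) y
  refine hext (h2.inter_of_isOpen_left (dense_sigmaPair_ne_zero hIm y) hopen)
    (hG continuous_const continuous_const continuous_id continuous_const) (fun z hz ↦ ?_) z
  refine hext h2 (hG continuous_const continuous_const continuous_const continuous_id)
    (fun w hw ↦ ?_) w
  refine hext (dense_sigmaPair_ne_zero hIm y)
    (hG continuous_id continuous_const continuous_const continuous_const) (fun x hx ↦ ?_) x
  exact sigmaPair_three_term_of_ne_zero hIm hy hz.1 hw hz.2 hx

/-- Weierstrass's fundamental identity. -/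
theorem weierstrass_fundamental_identity
    (ω₁ ω₃ : ℂ) (hω₁ : ω₁ ≠ 0) (hω₃ : ω₃ ≠ 0) (hIm : 0 < (ω₃ / ω₁).im)
    (a b c d : ℂ) :
    wSigma ω₁ ω₃ a * wSigma ω₁ ω₃ b * wSigma ω₁ ω₃ c * wSigma ω₁ ω₃ d +
      wSigma ω₁ ω₃ ((a + b + c + d) / 2) * wSigma ω₁ ω₃ ((a + b - c - d) / 2) *
        wSigma ω₁ ω₃ ((a - b + c - d) / 2) * wSigma ω₁ ω₃ ((-a + b + c - d) / 2) +
      wSigma ω₁ ω₃ ((a + b + c - d) / 2) * wSigma ω₁ ω₃ ((a + b - c + d) / 2) *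
        wSigma ω₁ ω₃ ((a - b + c + d) / 2) * wSigma ω₁ ω₃ ((a - b - c - d) / 2)
      = 0 := by
  have h := sigmaPair_three_term hIm ((a + b) / 2) ((a - b) / 2) ((c + d) / 2) ((c - d) / 2)
  simp only [sigmaPair] at h
  ring_nf at h ⊢
  linear_combination h
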